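/- arXiv:1305.4759 — 3 statements merged into one kernel-verified Lean document; each statement's English description precedes it below -/
import Mathlib

section
/- Let z_1, z_2, z_3 be real with |z_3 − z_1| < 2 and |z_3 − z_2| < 2, z_1 ≠ z_3, z_2 ≠ z_3, and let w_1, w_2, w_3 be distinct reals. Then C_2(z,w) = ∫_{ℝ²} dv_1 dv_2 · sinh(v_1 − v_2)·exp(v_1(z_3 − z_1) + v_2(z_3 − z_2)) / ∏_{j=1}^{3} ∏_{k=1}^{2} cosh(w_j − v_k) equals ∏_{j=1}^{2} [π/sin(π(z_3 − z_j)/2)] · ∏_{1 ≤ j < k ≤ 3} [1/sinh(w_j − w_k)] · ∑_{τ ∈ S_3} sgn(τ)·exp(w_{τ(1)}(z_3 − z_1) + w_{τ(2)}(z_3 − z_2)). -/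
open MeasureTheory

/-- Euler's reflection integral, in the logarithmic variable. -/
lemma integrable_and_integral_exp_mul_div_one_add_exp {s : ℝ} (hs0 : 0 < s) (hs1 : s < 1) :
    Integrable (fun u : ℝ => Real.exp (s * u) / (1 + Real.exp u)) ∧
      ∫ u : ℝ, Real.exp (s * u) / (1 + Real.exp u) = Real.pi / Real.sin (Real.pi * s) := by
  have hderiv : ∀ u ∈ (Set.univ : Set ℝ),
      HasDerivWithinAt Real.sigmoid (Real.sigmoid u * (1 - Real.sigmoid u)) Set.univ u :=
    fun u _ => (Real.hasDerivAt_sigmoid u).hasDerivWithinAt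
  have hinj : Set.InjOn Real.sigmoid Set.univ := Real.sigmoid_injective.injOn
  have himage : Real.sigmoid '' Set.univ = Set.Ioo 0 1 := by
    rw [Set.image_univ, Real.range_sigmoid]
  have hre0 : 0 < (s : ℂ).re := by simpa using hs0
  have hre1 : 0 < (1 - (s : ℂ)).re := by simpa using hs1
  have hbeta := Complex.betaIntegral_convergent hre0 hre1
  have hval : Complex.betaIntegral s (1 - s) =
      ((Real.pi / Real.sin (Real.pi * s) : ℝ) : ℂ) := by
    have h := Complex.Gamma_mul_Gamma_eq_betaIntegral hre0 hre1
    rw [Complex.Gamma_mul_Gamma_one_sub, add_sub_cancel, Complex.Gamma_one, one_mul] at h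
    rw [← h]
    push_cast
    rfl
  rw [Complex.betaIntegral, intervalIntegral.integral_of_le zero_le_one,
    integral_Ioc_eq_integral_Ioo, ← himage,
    integral_image_eq_integral_abs_deriv_smul MeasurableSet.univ hderiv hinj] at hval
  rw [intervalIntegrable_iff_integrableOn_Ioo_of_le zero_le_one, ← himage,
    integrableOn_image_iff_integrableOn_abs_deriv_smul MeasurableSet.univ hderiv hinj] at hbeta
  have hfun : (fun u : ℝ => |Real.sigmoid u * (1 - Real.sigmoid u)| •
      ((Real.sigmoid u : ℂ) ^ ((s : ℂ) - 1) *
        (1 - (Real.sigmoid u : ℂ)) ^ ((1 - (s : ℂ)) - 1))) =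
      fun u : ℝ => ((Real.exp (s * u) / (1 + Real.exp u) : ℝ) : ℂ) := by
    funext u
    have hσ0 := Real.sigmoid_pos u
    have hσ1 : 0 < 1 - Real.sigmoid u := sub_pos.2 (Real.sigmoid_lt_one u)
    have hreal : Real.sigmoid u * (1 - Real.sigmoid u) *
        (Real.sigmoid u ^ (s - 1) * (1 - Real.sigmoid u) ^ (1 - s - 1)) =
        Real.exp (s * u) / (1 + Real.exp u) := by
      have h1 : 1 - Real.sigmoid u = 1 / (1 + Real.exp u) := by
        rw [← Real.sigmoid_neg, Real.sigmoid_def, neg_neg, one_div]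
      have h2 : Real.sigmoid u = Real.exp u * (1 - Real.sigmoid u) := by
        rw [h1, Real.sigmoid_def, Real.exp_neg]
        field_simp
        ring
      calc _ = Real.sigmoid u ^ s * ((1 - Real.sigmoid u) ^ s)⁻¹ * (1 - Real.sigmoid u) := by
            rw [Real.rpow_sub_one hσ0.ne', Real.rpow_sub_one hσ1.ne', Real.rpow_sub hσ1,
              Real.rpow_one]
            field_simp
        _ = Real.exp (s * u) * (1 - Real.sigmoid u) := by
            nth_rewrite 1 [h2]
            rw [Real.mul_rpow (Real.exp_pos u).le hσ1.le, ← Real.exp_mul, mul_comm u s,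
              mul_inv_cancel_right₀ (Real.rpow_pos_of_pos hσ1 s).ne']
        _ = _ := by rw [h1, mul_one_div]
    rw [← hreal, abs_of_pos (mul_pos hσ0 hσ1), Complex.real_smul]
    push_cast [Complex.ofReal_cpow hσ0.le, Complex.ofReal_cpow hσ1.le]
    rfl
  rw [hfun, integrableOn_univ] at hbeta
  rw [hfun, Measure.restrict_univ, integral_complex_ofReal] at hval
  exact ⟨by simpa only [RCLike.re_to_complex, Complex.ofReal_re] using hbeta.re,
    Complex.ofReal_injective hval⟩

lemma Real.tanh_eq_exp_sub_exp_div (v w : ℝ) :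
    Real.tanh (v - w) = (Real.exp v ^ 2 - Real.exp w ^ 2) / (Real.exp v ^ 2 + Real.exp w ^ 2) := by
  rw [Real.tanh_eq_sinh_div_cosh, Real.sinh_eq, Real.cosh_eq, neg_sub, Real.exp_sub, Real.exp_sub]
  field_simp

lemma integrable_and_integral_tanh_sub_one_mul_exp {a : ℝ} (ha0 : 0 < a) (ha2 : a < 2) (w : ℝ) :
    Integrable (fun v : ℝ => (Real.tanh (v - w) - 1) * Real.exp (v * a)) ∧
      ∫ v : ℝ, (Real.tanh (v - w) - 1) * Real.exp (v * a) =
        -(Real.pi / Real.sin (Real.pi * a / 2) * Real.exp (w * a)) := by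
  obtain ⟨hint, hval⟩ := integrable_and_integral_exp_mul_div_one_add_exp
    (s := a / 2) (by linarith) (by linarith)
  have hfun : (fun v : ℝ => (Real.tanh (v - w) - 1) * Real.exp (v * a)) = fun v : ℝ =>
      (-2 * Real.exp (w * a)) *
        (Real.exp (a / 2 * (2 * (v - w))) / (1 + Real.exp (2 * (v - w)))) := by
    funext v
    have h1 : Real.exp (a / 2 * (2 * (v - w))) = Real.exp (v * a) / Real.exp (w * a) := by
      rw [← Real.exp_sub]
      ring_nf
    have h2 : Real.exp (2 * (v - w)) = Real.exp v ^ 2 / Real.exp w ^ 2 := by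
      rw [← Real.exp_nat_mul, ← Real.exp_nat_mul, ← Real.exp_sub]
      push_cast
      ring_nf
    rw [h1, h2, Real.tanh_eq_exp_sub_exp_div]
    field_simp
    ring
  rw [hfun]
  refine ⟨((hint.comp_mul_left' two_ne_zero).comp_sub_right w).const_mul _, ?_⟩
  rw [integral_const_mul,
    integral_sub_right_eq_self (fun v : ℝ => Real.exp (a / 2 * (2 * v)) / (1 + Real.exp (2 * v))) w,
    Measure.integral_comp_mul_left (fun v : ℝ => Real.exp (a / 2 * v) / (1 + Real.exp v)) 2, hval,
    mul_div_assoc, abs_of_pos (by norm_num), smul_eq_mul]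
  ring

/-- A constant shift of `tanh` makes its bilateral Laplace transform converge on each of the strips
`0 < a < 2` and `-2 < a < 0`, with the same formula for its value. -/
lemma exists_integrable_and_integral_tanh_add_mul_exp {a : ℝ} (ha : |a| < 2) (ha0 : a ≠ 0) :
    ∃ c : ℝ, ∀ w : ℝ, Integrable (fun v : ℝ => (Real.tanh (v - w) + c) * Real.exp (v * a)) ∧
      ∫ v : ℝ, (Real.tanh (v - w) + c) * Real.exp (v * a) =
        -(Real.pi / Real.sin (Real.pi * a / 2) * Real.exp (w * a)) := by
  obtain ⟨hlt, hgt⟩ := abs_lt.1 ha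
  rcases ha0.lt_or_gt with hneg | hpos
  · refine ⟨1, fun w => ?_⟩
    obtain ⟨hint, hval⟩ := integrable_and_integral_tanh_sub_one_mul_exp
      (a := -a) (by linarith) (by linarith) (-w)
    have hfun : (fun v : ℝ => (Real.tanh (v - w) + 1) * Real.exp (v * a)) =
        fun v : ℝ => -((Real.tanh (-v - -w) - 1) * Real.exp (-v * -a)) := by
      funext v
      rw [show -v - -w = -(v - w) by ring, Real.tanh_neg, neg_mul_neg]
      ring
    rw [hfun]
    refine ⟨hint.comp_neg.neg, ?_⟩
    rw [integral_neg, integral_neg_eq_self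
      (fun v : ℝ => (Real.tanh (v - -w) - 1) * Real.exp (v * -a)) volume, hval, neg_mul_neg,
      show Real.pi * -a / 2 = -(Real.pi * a / 2) by ring, Real.sin_neg]
    ring
  · exact ⟨-1, integrable_and_integral_tanh_sub_one_mul_exp hpos hgt⟩

lemma Equiv.Perm.sum_fin_three_sign_mul (F : Fin 3 → Fin 3 → ℝ) :
    ∑ τ : Equiv.Perm (Fin 3), ((Equiv.Perm.sign τ : ℤ) : ℝ) * F (τ 0) (τ 1) =
      F 0 1 - F 0 2 - F 1 0 + F 1 2 + F 2 0 - F 2 1 := by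
  have huniv : (Finset.univ : Finset (Equiv.Perm (Fin 3))) =
      {1, Equiv.swap 0 1, Equiv.swap 0 2, Equiv.swap 1 2, Equiv.swap 0 1 * Equiv.swap 1 2,
        Equiv.swap 1 2 * Equiv.swap 0 1} := by decide
  rw [huniv, Finset.sum_insert (by decide), Finset.sum_insert (by decide),
    Finset.sum_insert (by decide), Finset.sum_insert (by decide), Finset.sum_insert (by decide),
    Finset.sum_singleton]
  have h01 : Equiv.swap (0 : Fin 3) 1 2 = 2 := by decide
  have h02 : Equiv.swap (0 : Fin 3) 2 1 = 1 := by decide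
  have h12 : Equiv.swap (1 : Fin 3) 2 0 = 0 := by decide
  simp [h01, h02, h12]
  ring

/-- A confluent Cauchy determinant: the shifts `c` and `d` only change the columns by multiples of
a constant column. -/
lemma sinh_sub_div_prod_cosh (w : Fin 3 → ℝ) (hw : Function.Injective w) (c d x y : ℝ) :
    Real.sinh (x - y) /
        ((Real.cosh (w 0 - x) * Real.cosh (w 0 - y)) *
         (Real.cosh (w 1 - x) * Real.cosh (w 1 - y)) *
         (Real.cosh (w 2 - x) * Real.cosh (w 2 - y))) =
      1 / (Real.sinh (w 0 - w 1) * Real.sinh (w 0 - w 2) * Real.sinh (w 1 - w 2)) *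
        ∑ τ : Equiv.Perm (Fin 3), ((Equiv.Perm.sign τ : ℤ) : ℝ) *
          ((Real.tanh (x - w (τ 0)) + c) * (Real.tanh (y - w (τ 1)) + d)) := by
  have hsinh : ∀ i j : Fin 3, i ≠ j → Real.sinh (w i - w j) ≠ 0 := fun i j hij =>
    Real.sinh_ne_zero.2 (sub_ne_zero.2 (hw.ne hij))
  have h01 := hsinh 0 1 (by decide)
  have h02 := hsinh 0 2 (by decide)
  have h12 := hsinh 1 2 (by decide)
  have hsinh_exp : ∀ p q : ℝ, Real.sinh (p - q) =
      (Real.exp p ^ 2 - Real.exp q ^ 2) / (2 * Real.exp p * Real.exp q) := by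
    intro p q
    rw [Real.sinh_eq, neg_sub, Real.exp_sub, Real.exp_sub]
    field_simp
  have hcosh_exp : ∀ p q : ℝ, Real.cosh (p - q) =
      (Real.exp p ^ 2 + Real.exp q ^ 2) / (2 * Real.exp p * Real.exp q) := by
    intro p q
    rw [Real.cosh_eq, neg_sub, Real.exp_sub, Real.exp_sub]
    field_simp
  rw [Equiv.Perm.sum_fin_three_sign_mul
    (fun i j => (Real.tanh (x - w i) + c) * (Real.tanh (y - w j) + d)),
    one_div_mul_eq_div, eq_div_iff (mul_ne_zero (mul_ne_zero h01 h02) h12)]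
  simp only [hsinh_exp, hcosh_exp, Real.tanh_eq_exp_sub_exp_div]
  have hx := Real.exp_pos x
  have hy := Real.exp_pos y
  have h0 := Real.exp_pos (w 0)
  have h1 := Real.exp_pos (w 1)
  have h2 := Real.exp_pos (w 2)
  generalize Real.exp x = X at *
  generalize Real.exp y = Y at *
  generalize Real.exp (w 0) = A at *
  generalize Real.exp (w 1) = B at *
  generalize Real.exp (w 2) = C at *
  field_simp
  ring

/-- Evaluation of the integral `C₂(z,w)` in terms of a signed sum over `S₃`. -/
theorem C2_eval (z : Fin 3 → ℝ) (w : Fin 3 → ℝ)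
    (hz1 : |z 2 - z 0| < 2) (hz2 : |z 2 - z 1| < 2)
    (hz1' : z 0 ≠ z 2) (hz2' : z 1 ≠ z 2)
    (hw : Function.Injective w) :
    ∫ v : ℝ × ℝ, Real.sinh (v.1 - v.2) *
        Real.exp (v.1 * (z 2 - z 0) + v.2 * (z 2 - z 1)) /
        ((Real.cosh (w 0 - v.1) * Real.cosh (w 0 - v.2)) *
         (Real.cosh (w 1 - v.1) * Real.cosh (w 1 - v.2)) *
         (Real.cosh (w 2 - v.1) * Real.cosh (w 2 - v.2)))
      = (Real.pi / Real.sin (Real.pi * (z 2 - z 0) / 2)) *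
        (Real.pi / Real.sin (Real.pi * (z 2 - z 1) / 2)) *
        (1 / (Real.sinh (w 0 - w 1) * Real.sinh (w 0 - w 2) * Real.sinh (w 1 - w 2))) *
        ∑ τ : Equiv.Perm (Fin 3),
          ((Equiv.Perm.sign τ : ℤ) : ℝ) *
            Real.exp (w (τ 0) * (z 2 - z 0) + w (τ 1) * (z 2 - z 1)) := by
  set a := z 2 - z 0 with ha
  set b := z 2 - z 1 with hb
  obtain ⟨c, hc⟩ := exists_integrable_and_integral_tanh_add_mul_exp hz1 (sub_ne_zero.2 hz1'.symm)
  obtain ⟨d, hd⟩ := exists_integrable_and_integral_tanh_add_mul_exp hz2 (sub_ne_zero.2 hz2'.symm)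
  have hfun : ∀ v : ℝ × ℝ, Real.sinh (v.1 - v.2) * Real.exp (v.1 * a + v.2 * b) /
        ((Real.cosh (w 0 - v.1) * Real.cosh (w 0 - v.2)) *
         (Real.cosh (w 1 - v.1) * Real.cosh (w 1 - v.2)) *
         (Real.cosh (w 2 - v.1) * Real.cosh (w 2 - v.2))) =
      1 / (Real.sinh (w 0 - w 1) * Real.sinh (w 0 - w 2) * Real.sinh (w 1 - w 2)) *
        ∑ τ : Equiv.Perm (Fin 3), ((Equiv.Perm.sign τ : ℤ) : ℝ) *
          (((Real.tanh (v.1 - w (τ 0)) + c) * Real.exp (v.1 * a)) *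
            ((Real.tanh (v.2 - w (τ 1)) + d) * Real.exp (v.2 * b))) := by
    intro v
    rw [mul_div_right_comm, sinh_sub_div_prod_cosh w hw c d, Real.exp_add, mul_assoc,
      Finset.sum_mul]
    congr 1
    exact Finset.sum_congr rfl fun τ _ => by ring
  simp_rw [hfun]
  rw [integral_const_mul, integral_finsetSum _ fun τ _ =>
    (((hc (w (τ 0))).1.mul_prod (hd (w (τ 1))).1).const_mul _), Finset.mul_sum, Finset.mul_sum]
  refine Finset.sum_congr rfl fun τ _ => ?_
  rw [integral_const_mul, Measure.volume_eq_prod,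
    integral_prod_mul (fun x : ℝ => (Real.tanh (x - w (τ 0)) + c) * Real.exp (x * a))
      (fun y : ℝ => (Real.tanh (y - w (τ 1)) + d) * Real.exp (y * b)),
    (hc _).2, (hd _).2, Real.exp_add]
  ring
end

section
/- Let λ be complex with Re λ > 0 and let u_1, u_2 be real. Define I_2(λ; t, u, s) = exp(i s (u_1 − u_2))·∏_{j=1}^{2} (2 cosh(t_j − s))^{−λ} (principal powers). For (t_1, t_2) in the domain A_2 = {t ∈ ℂ² : |Im(t_1 − t_2)| < π}, setting η = Im(t_1 + t_2)/2, the function F_2(λ; t, u) = exp(i u_2 (t_1 + t_2))·∫_{ℝ + iη} I_2(λ; t, u, s) ds is well defined (the integral converges absolutely) and is holomorphic jointly in (λ, t) on {Re λ > 0} × A_2. -/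
open MeasureTheory

/-- The integrand `I₂(λ;t,u,s) = e^{is(u₁−u₂)} ∏_{j=1}^2 (2cosh(t_j−s))^{-λ}`. -/
noncomputable def I2 (lam t₁ t₂ : ℂ) (u₁ u₂ : ℝ) (s : ℂ) : ℂ :=
  Complex.exp (Complex.I * s * (u₁ - u₂)) *
    (2 * Complex.cosh (t₁ - s)) ^ (-lam) * (2 * Complex.cosh (t₂ - s)) ^ (-lam)

/-- `F₂(λ;t,u)`, defined by integration over the shifted contour `ℝ + iη`,
`η = Im(t₁+t₂)/2`. -/
noncomputable def F2c (lam t₁ t₂ : ℂ) (u₁ u₂ : ℝ) : ℂ :=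
  Complex.exp (Complex.I * u₂ * (t₁ + t₂)) *
    ∫ x : ℝ, I2 lam t₁ t₂ u₁ u₂ (x + Complex.I * ((t₁.im + t₂.im) / 2))

open Filter Topology Metric

/-- Differentiation under the integral sign for a jointly analytic kernel which is locally
dominated: the derivative bound comes from the Schwarz lemma. -/
theorem differentiableAt_integral_of_analyticAt_of_dominated {E : Type*} [NormedAddCommGroup E]
    [NormedSpace ℂ E] {K : E → ℂ → ℂ} {p₀ : E} {bound : ℝ → ℝ}
    (hK : ∀ᶠ p in 𝓝 p₀, ∀ x : ℝ, ContDiffAt ℂ 2 (Function.uncurry K) (p, (x : ℂ)))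
    (hbound : ∀ᶠ p in 𝓝 p₀, ∀ x : ℝ, ‖K p x‖ ≤ bound x) (hint : Integrable bound) :
    Integrable (fun x : ℝ => K p₀ x) ∧
      DifferentiableAt ℂ (fun p => ∫ x : ℝ, K p x) p₀ := by
  have hmeas : ∀ᶠ p in 𝓝 p₀, AEStronglyMeasurable (fun x : ℝ => K p x) := by
    filter_upwards [hK] with p hp
    refine Continuous.aestronglyMeasurable (continuous_iff_continuousAt.2 fun x => ?_)
    have h1 : ContinuousAt (fun x : ℝ => (p, (x : ℂ))) x := by fun_prop
    exact ContinuousAt.comp (f := fun x : ℝ => (p, (x : ℂ))) (hp x).continuousAt h1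
  have hint₀ : Integrable (fun x : ℝ => K p₀ x) :=
    hint.mono' hmeas.self_of_nhds (Eventually.of_forall hbound.self_of_nhds)
  refine ⟨hint₀, ?_⟩
  obtain ⟨ε, hε, hball⟩ := Metric.mem_nhds_iff.1 (hK.and hbound)
  have hdiff : ∀ p ∈ ball p₀ ε, ∀ x : ℝ, DifferentiableAt ℂ (fun q => K q x) p := by
    intro p hp x
    have h1 : DifferentiableAt ℂ (fun q : E => (q, (x : ℂ))) p := by fun_prop
    exact DifferentiableAt.comp (f := fun q : E => (q, (x : ℂ))) p
      (((hball hp).1 x).differentiableAt (by norm_num)) h1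
  refine (hasFDerivAt_integral_of_dominated_of_fderiv_le (𝕜 := ℂ)
    (F := fun p (x : ℝ) => K p x)
    (F' := fun p (x : ℝ) => fderiv ℂ (fun q => K q x) p)
    (bound := fun x => 2 * bound x / (ε / 2))
    (ball_mem_nhds p₀ (half_pos hε)) hmeas hint₀ ?_ ?_ ?_ ?_).differentiableAt
  · refine Continuous.aestronglyMeasurable (continuous_iff_continuousAt.2 fun x => ?_)
    have h1 : ContDiffAt ℂ 2 (Function.uncurry fun (z : ℂ) (q : E) => K q z) ((x : ℂ), p₀) :=
      ContDiffAt.comp (f := fun y : ℂ × E => (y.2, y.1)) (g := Function.uncurry K)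
        ((x : ℂ), p₀) (hK.self_of_nhds x) (by fun_prop)
    have h2 := (ContDiffAt.fderiv (m := 0) h1 (contDiffAt_const (c := p₀))
      (by norm_num)).continuousAt
    exact ContinuousAt.comp (f := fun x : ℝ => (x : ℂ)) h2 (by fun_prop)
  · refine Eventually.of_forall fun x p hp => ?_
    have hsub : ball p (ε / 2) ⊆ ball p₀ ε :=
      ball_subset_ball' (by rw [mem_ball] at hp; linarith)
    refine Complex.norm_fderiv_le_div_of_mapsTo_ball (f := fun q => K q x)
      (fun q hq => (hdiff q (hsub hq) x).differentiableWithinAt) (fun q hq => ?_) (half_pos hε)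
    have h1 := (hball (hsub hq)).2 x
    have h2 := (hball (hsub (mem_ball_self (half_pos hε)))).2 x
    rw [mem_closedBall, dist_eq_norm]
    linarith [norm_sub_le (K q x) (K p x)]
  · exact (hint.const_mul 2).div_const _
  · refine Eventually.of_forall fun x p hp => ?_
    exact (hdiff p (ball_subset_ball (by linarith) hp) x).hasFDerivAt

theorem integrable_exp_sub_mul_abs (C : ℝ) {a : ℝ} (ha : 0 < a) :
    Integrable (fun x : ℝ => Real.exp (C - a * |x|)) := by
  have h : Integrable (fun x : ℝ => Real.exp (-(a * |x|))) := by
    rw [← integrableOn_univ, ← Set.Iic_union_Ioi (a := (0 : ℝ))]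
    refine IntegrableOn.union ?_ ?_
    · refine (integrableOn_exp_mul_Iic ha 0).congr_fun (fun x hx => ?_) measurableSet_Iic
      simp [abs_of_nonpos (Set.mem_Iic.1 hx)]
    · refine (integrableOn_exp_mul_Ioi (neg_lt_zero.2 ha) 0).congr_fun (fun x hx => ?_)
        measurableSet_Ioi
      simp [abs_of_pos (Set.mem_Ioi.1 hx)]
  simpa [sub_eq_add_neg, Real.exp_add] using h.const_mul (Real.exp C)

theorem two_mul_cosh_re (z : ℂ) :
    (2 * Complex.cosh z).re = 2 * Real.cosh z.re * Real.cos z.im := by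
  conv_lhs => rw [← Complex.re_add_im z, Complex.cosh_add, Complex.cosh_mul_I, Complex.sinh_mul_I,
    ← Complex.ofReal_cosh, ← Complex.ofReal_cos, ← Complex.ofReal_sinh, ← Complex.ofReal_sin]
  simp [-Complex.ofReal_cos, -Complex.ofReal_sin, -Complex.ofReal_cosh, -Complex.ofReal_sinh]
  ring

theorem cos_im_pos {z : ℂ} (hz : |z.im| < Real.pi / 2) : 0 < Real.cos z.im :=
  Real.cos_pos_of_mem_Ioo (abs_lt.1 hz)

theorem two_mul_cosh_mem_slitPlane {z : ℂ} (hz : |z.im| < Real.pi / 2) :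
    2 * Complex.cosh z ∈ Complex.slitPlane := by
  left
  rw [two_mul_cosh_re]
  have := cos_im_pos hz
  have := Real.cosh_pos z.re
  positivity

theorem exp_abs_le_two_mul_cosh (x : ℝ) : Real.exp |x| ≤ 2 * Real.cosh x := by
  rw [← Real.cosh_abs, Real.cosh_eq]
  linarith [Real.exp_pos (-|x|)]

theorem norm_two_mul_cosh_cpow_neg_le {lam z : ℂ} {c L : ℝ} (hlam : 0 ≤ lam.re) (hL : ‖lam‖ ≤ L)
    (hc : 0 < c) (hcz : c ≤ Real.cos z.im) :
    ‖(2 * Complex.cosh z) ^ (-lam)‖ ≤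
      Real.exp ((Real.pi - Real.log c) * L - lam.re * |z.re|) := by
  have hlog : Real.log c ≤ 0 := Real.log_nonpos hc.le (hcz.trans (Real.cos_le_one _))
  have hre : lam.re ≤ L := (Complex.re_le_norm lam).trans hL
  have him : |lam.im| ≤ L := (Complex.abs_im_le_norm lam).trans hL
  have hlow : Real.exp (|z.re| + Real.log c) ≤ ‖2 * Complex.cosh z‖ := by
    refine le_trans ?_ (Complex.re_le_norm _)
    rw [two_mul_cosh_re, Real.exp_add, Real.exp_log hc]
    have := exp_abs_le_two_mul_cosh z.re
    gcongr
  refine (Complex.norm_cpow_le _ _).trans ?_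
  rw [div_eq_mul_inv, ← Real.exp_neg, Complex.neg_re, Complex.neg_im]
  have h1 : ‖2 * Complex.cosh z‖ ^ (-lam.re) ≤
      Real.exp ((|z.re| + Real.log c) * (-lam.re)) := by
    rw [Real.exp_mul]
    exact Real.rpow_le_rpow_of_nonpos (Real.exp_pos _) hlow (by linarith)
  have h2 : -((2 * Complex.cosh z).arg * -lam.im) ≤ Real.pi * L := by
    rw [mul_neg, neg_neg]
    refine (le_abs_self _).trans ?_
    rw [abs_mul]
    exact mul_le_mul (Complex.abs_arg_le_pi _) him (abs_nonneg _) Real.pi_pos.le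
  refine (mul_le_mul h1 (Real.exp_le_exp.2 h2) (Real.exp_pos _).le (Real.exp_pos _).le).trans ?_
  rw [← Real.exp_add, Real.exp_le_exp]
  nlinarith

/-- The integrand in the symmetric variables `p = (λ, w)`, where `w = (t₁ - t₂) / 2`. -/
noncomputable def symmKernel (u : ℝ) (p : ℂ × ℂ) (z : ℂ) : ℂ :=
  Complex.exp (Complex.I * z * u) * (2 * Complex.cosh (p.2 - z)) ^ (-p.1) *
    (2 * Complex.cosh (-p.2 - z)) ^ (-p.1)

theorem norm_symmKernel_le {u : ℝ} {p : ℂ × ℂ} {c l L : ℝ} (hl : 0 ≤ l) (hlp : l ≤ p.1.re)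
    (hL : ‖p.1‖ ≤ L) (hc : 0 < c) (hcp : c ≤ Real.cos p.2.im) (x : ℝ) :
    ‖symmKernel u p x‖ ≤ Real.exp (2 * ((Real.pi - Real.log c) * L) - 2 * l * |x|) := by
  have h0 : ‖Complex.exp (Complex.I * x * u)‖ = 1 := by
    rw [Complex.norm_exp]
    simp
  have h1 := norm_two_mul_cosh_cpow_neg_le (z := p.2 - x) (hl.trans hlp) hL hc (by simpa using hcp)
  have h2 := norm_two_mul_cosh_cpow_neg_le (z := -p.2 - x) (hl.trans hlp) hL hc
    (by simpa using hcp)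
  rw [symmKernel, norm_mul, norm_mul, h0, one_mul]
  refine (mul_le_mul h1 h2 (norm_nonneg _) (Real.exp_pos _).le).trans ?_
  rw [← Real.exp_add, Real.exp_le_exp]
  have h3 : 2 * |x| ≤ |(p.2 - x).re| + |(-p.2 - x).re| := by
    have := abs_add_le (p.2 - x).re (-p.2 - x).re
    have h4 : (p.2 - x).re + (-p.2 - x).re = -(2 * x) := by simp; ring
    rwa [h4, abs_neg, abs_mul, abs_two] at this
  nlinarith [mul_le_mul hlp h3 (by positivity) (hl.trans hlp)]

theorem contDiffAt_symmKernel (u : ℝ) {p : ℂ × ℂ} (hp : |p.2.im| < Real.pi / 2) (x : ℝ) :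
    ContDiffAt ℂ 2 (Function.uncurry (symmKernel u)) (p, (x : ℂ)) := by
  have hcosh : AnalyticOnNhd ℂ Complex.cosh Set.univ :=
    Complex.differentiable_cosh.differentiableOn.analyticOnNhd isOpen_univ
  have hz : AnalyticAt ℂ (fun q : (ℂ × ℂ) × ℂ => q.2) (p, (x : ℂ)) := analyticAt_snd
  have hlam : AnalyticAt ℂ (fun q : (ℂ × ℂ) × ℂ => q.1.1) (p, (x : ℂ)) :=
    AnalyticAt.comp (f := fun q : (ℂ × ℂ) × ℂ => q.1) analyticAt_fst analyticAt_fst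
  have hw : AnalyticAt ℂ (fun q : (ℂ × ℂ) × ℂ => q.1.2) (p, (x : ℂ)) :=
    AnalyticAt.comp (f := fun q : (ℂ × ℂ) × ℂ => q.1) analyticAt_snd analyticAt_fst
  have h1 : AnalyticAt ℂ (fun q : (ℂ × ℂ) × ℂ => (2 * Complex.cosh (q.1.2 - q.2)) ^ (-q.1.1))
      (p, (x : ℂ)) :=
    AnalyticAt.cpow (analyticAt_const.mul ((hcosh _ (Set.mem_univ _)).fun_comp (hw.sub hz)))
      hlam.neg (two_mul_cosh_mem_slitPlane (by simpa using hp))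
  have h2 : AnalyticAt ℂ (fun q : (ℂ × ℂ) × ℂ => (2 * Complex.cosh (-q.1.2 - q.2)) ^ (-q.1.1))
      (p, (x : ℂ)) :=
    AnalyticAt.cpow (analyticAt_const.mul ((hcosh _ (Set.mem_univ _)).fun_comp (hw.neg.sub hz)))
      hlam.neg (two_mul_cosh_mem_slitPlane (by simpa using hp))
  have h3 : AnalyticAt ℂ (fun q : (ℂ × ℂ) × ℂ => Complex.exp (Complex.I * q.2 * u))
      (p, (x : ℂ)) := ((analyticAt_const.mul hz).mul analyticAt_const).cexp
  exact ((h3.mul h1).mul h2).contDiffAt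

theorem integrable_and_differentiableAt_integral_symmKernel (u : ℝ) {p : ℂ × ℂ}
    (hp₁ : 0 < p.1.re) (hp₂ : |p.2.im| < Real.pi / 2) :
    Integrable (fun x : ℝ => symmKernel u p x) ∧
      DifferentiableAt ℂ (fun q => ∫ x : ℝ, symmKernel u q x) p := by
  have hc := cos_im_pos hp₂
  have ev₁ : ∀ᶠ q : ℂ × ℂ in 𝓝 p, |q.2.im| < Real.pi / 2 :=
    ContinuousAt.eventually_lt (by fun_prop) (by fun_prop) hp₂
  have ev₂ : ∀ᶠ q : ℂ × ℂ in 𝓝 p, p.1.re / 2 < q.1.re :=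
    ContinuousAt.eventually_lt (by fun_prop) (by fun_prop) (half_lt_self hp₁)
  have ev₃ : ∀ᶠ q : ℂ × ℂ in 𝓝 p, ‖q.1‖ < ‖p.1‖ + 1 :=
    ContinuousAt.eventually_lt (by fun_prop) (by fun_prop) (lt_add_one _)
  have ev₄ : ∀ᶠ q : ℂ × ℂ in 𝓝 p, Real.cos p.2.im / 2 < Real.cos q.2.im :=
    ContinuousAt.eventually_lt (by fun_prop) (by fun_prop) (half_lt_self hc)
  refine differentiableAt_integral_of_analyticAt_of_dominated
    (ev₁.mono fun q hq x => contDiffAt_symmKernel u hq x) ?_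
    (integrable_exp_sub_mul_abs
      (2 * ((Real.pi - Real.log (Real.cos p.2.im / 2)) * (‖p.1‖ + 1)))
      (a := 2 * (p.1.re / 2)) (by linarith))
  filter_upwards [ev₂, ev₃, ev₄] with q h₂ h₃ h₄ x
  exact norm_symmKernel_le (half_pos hp₁).le h₂.le h₃.le (half_pos hc) h₄.le x

/-- After the real translation `x ↦ x + Re (t₁ + t₂) / 2` the shifted contour integrand becomes
the symmetric kernel, up to a factor holomorphic in `t₁ + t₂`. -/
theorem I2_contour_eq (lam t₁ t₂ : ℂ) (u₁ u₂ x : ℝ) :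
    I2 lam t₁ t₂ u₁ u₂ (x + Complex.I * ((t₁.im + t₂.im) / 2)) =
      Complex.exp (Complex.I * ((t₁ + t₂) / 2) * (u₁ - u₂)) *
        symmKernel (u₁ - u₂) (lam, (t₁ - t₂) / 2) ((x - (t₁.re + t₂.re) / 2 : ℝ) : ℂ) := by
  have hs : (x + Complex.I * ((t₁.im + t₂.im) / 2) : ℂ) =
      ((x - (t₁.re + t₂.re) / 2 : ℝ) : ℂ) + (t₁ + t₂) / 2 := by
    apply Complex.ext <;> simp
  rw [hs]
  generalize ((x - (t₁.re + t₂.re) / 2 : ℝ) : ℂ) = y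
  rw [I2, symmKernel, ← mul_assoc, ← mul_assoc, ← Complex.exp_add]
  congr 3
  · push_cast
    ring
  · congr 2
    ring
  · congr 1
    ring

theorem F2c_eq_integral_symmKernel (lam t₁ t₂ : ℂ) (u₁ u₂ : ℝ) :
    F2c lam t₁ t₂ u₁ u₂ =
      Complex.exp (Complex.I * u₂ * (t₁ + t₂)) *
        (Complex.exp (Complex.I * ((t₁ + t₂) / 2) * (u₁ - u₂)) *
          ∫ x : ℝ, symmKernel (u₁ - u₂) (lam, (t₁ - t₂) / 2) x) := by
  simp_rw [F2c, I2_contour_eq]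
  rw [integral_const_mul,
    integral_sub_right_eq_self (fun x : ℝ => symmKernel (u₁ - u₂) (lam, (t₁ - t₂) / 2) x)]

theorem abs_im_half_lt {z : ℂ} (hz : |z.im| < Real.pi) : |(z / 2).im| < Real.pi / 2 := by
  have h : (z / 2).im = z.im / 2 := by simp
  rw [h, abs_div, abs_two]
  linarith

/-- The contour integral defining `F₂` converges absolutely, and `F₂` is
holomorphic jointly in `(λ, t₁, t₂)` on `{Re λ > 0} × A₂`. -/
theorem F2c_integrable_and_holomorphic (u₁ u₂ : ℝ) :
    (∀ lam t₁ t₂ : ℂ, 0 < lam.re → |(t₁ - t₂).im| < Real.pi →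
      Integrable (fun x : ℝ =>
        I2 lam t₁ t₂ u₁ u₂ (x + Complex.I * ((t₁.im + t₂.im) / 2)))) ∧
    DifferentiableOn ℂ (fun p : ℂ × ℂ × ℂ => F2c p.1 p.2.1 p.2.2 u₁ u₂)
      {p : ℂ × ℂ × ℂ | 0 < p.1.re ∧ |(p.2.1 - p.2.2).im| < Real.pi} := by
  refine ⟨fun lam t₁ t₂ hlam ht => ?_, fun p hp => ?_⟩
  · simp_rw [I2_contour_eq]
    exact ((integrable_and_differentiableAt_integral_symmKernel (u₁ - u₂)
      (p := (lam, (t₁ - t₂) / 2)) hlam (abs_im_half_lt ht)).1.comp_sub_right _).const_mul _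
  · refine DifferentiableAt.differentiableWithinAt ?_
    simp_rw [F2c_eq_integral_symmKernel]
    have h := (integrable_and_differentiableAt_integral_symmKernel (u₁ - u₂)
      (p := (p.1, (p.2.1 - p.2.2) / 2)) hp.1 (abs_im_half_lt hp.2)).2
    have hcomp : DifferentiableAt ℂ (fun q : ℂ × ℂ × ℂ =>
        ∫ x : ℝ, symmKernel (u₁ - u₂) (q.1, (q.2.1 - q.2.2) / 2) x) p :=
      DifferentiableAt.comp (f := fun q : ℂ × ℂ × ℂ => (q.1, (q.2.1 - q.2.2) / 2)) p h
        (by fun_prop)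
    exact DifferentiableAt.mul (by fun_prop) (DifferentiableAt.mul (by fun_prop) hcomp)
end

section
/- For real numbers w_1, …, w_N with N ≥ 2, the (N−1)-dimensional integral B_{N−1}(w) = ∫_{ℝ^{N−1}} dv · ∏_{1 ≤ m < n ≤ N−1} (v_m − v_n)·sinh(v_m − v_n) / ∏_{j=1}^{N} ∏_{k=1}^{N−1} cosh(w_j − v_k) equals 2^{N−1}·∏_{1 ≤ m < n ≤ N} (w_m − w_n)/sinh(w_m − w_n), with each ratio x/sinh x interpreted as 1 at x = 0. -/
open MeasureTheory Finset

/-- `x/sinh x`, extended by `1` at `x = 0`. -/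
noncomputable def shr (x : ℝ) : ℝ := if x = 0 then 1 else x / Real.sinh x

open Matrix in
/-- If the first column of `A` vanishes below its first entry, the determinant of `A` is that entry
times the complementary minor. -/
theorem det_eq_mul_det_submatrix_succ {R : Type*} [CommRing R] {n : ℕ}
    (A : Matrix (Fin (n + 1)) (Fin (n + 1)) R) (h : ∀ i : Fin n, A i.succ 0 = 0) :
    A.det = A 0 0 * (A.submatrix Fin.succ Fin.succ).det := by
  rw [det_succ_column_zero, Fin.sum_univ_succ]
  simp [h]

open Matrix in
/-- A matrix whose first column is constantly `1` has the determinant of the matrix of differences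
with its first row. -/
theorem det_eq_det_sub_first_row {R : Type*} [CommRing R] {n : ℕ}
    (A : Matrix (Fin (n + 1)) (Fin (n + 1)) R) (h : ∀ i, A i 0 = 1) :
    A.det = (Matrix.of fun i j : Fin n => A i.succ j.succ - A 0 j.succ).det := by
  let B : Matrix (Fin (n + 1)) (Fin (n + 1)) R :=
    .of fun i j => A i j - (if i = 0 then 0 else 1) * A 0 j
  have hAB : A.det = B.det := by
    refine det_eq_of_forall_row_eq_smul_add_const (fun i => if i = 0 then 0 else 1) 0 (by simp) ?_
    intro i j
    simp [B]
  rw [hAB, det_eq_mul_det_submatrix_succ B (by simp [B, h])]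
  have h00 : B 0 0 = 1 := by simp [B, h]
  rw [h00, one_mul]
  congr 1
  ext i j
  simp [B]

theorem cosh_mul_cosh_sub_cosh_mul_cosh (a b c d : ℝ) :
    Real.cosh (a - d) * Real.cosh (b - c) - Real.cosh (b - d) * Real.cosh (a - c)
      = Real.sinh (a - b) * Real.sinh (c - d) := by
  simp only [Real.cosh_sub, Real.sinh_sub]
  ring

/-- The Cauchy determinant in hyperbolic form. -/
theorem det_inv_cosh_sub {n : ℕ} (x y : Fin n → ℝ) :
    (Matrix.of fun i j => (Real.cosh (x i - y j))⁻¹).det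
      = (∏ i, ∏ j ∈ Ioi i, Real.sinh (x j - x i) * Real.sinh (y j - y i)) /
        ∏ i, ∏ j, Real.cosh (x i - y j) := by
  induction n with
  | zero => simp
  | succ n ih =>
    let c : Fin (n + 1) → ℝ := fun i =>
      if i = 0 then 0 else Real.cosh (x 0 - y 0) / Real.cosh (x i - y 0)
    let B : Matrix (Fin (n + 1)) (Fin (n + 1)) ℝ :=
      .of fun i j => (Real.cosh (x i - y j))⁻¹ - c i * (Real.cosh (x 0 - y j))⁻¹
    have hne (t : ℝ) : Real.cosh t ≠ 0 := (Real.cosh_pos t).ne'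
    have hdet : (Matrix.of fun i j => (Real.cosh (x i - y j))⁻¹).det = B.det := by
      refine Matrix.det_eq_of_forall_row_eq_smul_add_const c 0 (by simp [c]) ?_
      intro i j
      simp [B, c]
    have hB0 (i : Fin n) : B i.succ 0 = 0 := by
      have := hne (x 0 - y 0)
      have := hne (x i.succ - y 0)
      simp only [B, c, Matrix.of_apply, Fin.succ_ne_zero, if_false]
      field_simp
      simp
    have hB00 : B 0 0 = (Real.cosh (x 0 - y 0))⁻¹ := by simp [B, c]
    have hsub : B.submatrix Fin.succ Fin.succ =
        .of fun i j => (Real.sinh (x i.succ - x 0) / Real.cosh (x i.succ - y 0)) *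
          (Matrix.of fun i j => (Real.sinh (y j.succ - y 0) / Real.cosh (x 0 - y j.succ)) *
            (Matrix.of fun i j : Fin n => (Real.cosh (x i.succ - y j.succ))⁻¹) i j) i j := by
      ext i j
      have h1 := hne (x i.succ - y 0)
      have h2 := hne (x 0 - y j.succ)
      have h3 := hne (x i.succ - y j.succ)
      have key := cosh_mul_cosh_sub_cosh_mul_cosh (x i.succ) (x 0) (y j.succ) (y 0)
      simp only [B, c, Matrix.of_apply, Matrix.submatrix_apply, Fin.succ_ne_zero, if_false]
      field_simp
      linear_combination key
    rw [hdet, det_eq_mul_det_submatrix_succ B hB0, hB00, hsub, Matrix.det_mul_column,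
      Matrix.det_mul_row, ih (fun i => x i.succ) (fun i => y i.succ)]
    simp only [Fin.prod_univ_succ, Fin.prod_Ioi_zero, Fin.prod_Ioi_succ, Finset.prod_mul_distrib,
      Finset.prod_div_distrib]
    have h1 : ∏ i : Fin n, Real.cosh (x i.succ - y 0) ≠ 0 := prod_ne_zero_iff.2 fun i _ => hne _
    have h2 : ∏ i : Fin n, Real.cosh (x 0 - y i.succ) ≠ 0 := prod_ne_zero_iff.2 fun i _ => hne _
    have h3 : ∏ i : Fin n, ∏ j : Fin n, Real.cosh (x i.succ - y j.succ) ≠ 0 :=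
      prod_ne_zero_iff.2 fun i _ => prod_ne_zero_iff.2 fun j _ => hne _
    have h4 := hne (x 0 - y 0)
    field_simp

theorem tanh_sub_tanh (a b : ℝ) :
    Real.tanh a - Real.tanh b = Real.sinh (a - b) * (Real.cosh a)⁻¹ * (Real.cosh b)⁻¹ := by
  have ha := (Real.cosh_pos a).ne'
  have hb := (Real.cosh_pos b).ne'
  rw [Real.tanh_eq_sinh_div_cosh, Real.tanh_eq_sinh_div_cosh, Real.sinh_sub]
  field_simp

/-- The determinant of differences of hyperbolic tangents. -/
theorem det_tanh_sub_tanh {n : ℕ} (w : Fin (n + 1) → ℝ) (v : Fin n → ℝ) :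
    (Matrix.of fun i k => Real.tanh (w i.succ - v k) - Real.tanh (w 0 - v k)).det
      = (∏ i, ∏ j ∈ Ioi i, Real.sinh (w j - w i)) * (∏ i, ∏ j ∈ Ioi i, Real.sinh (v j - v i)) /
        ∏ j, ∏ k, Real.cosh (w j - v k) := by
  have hmat : (Matrix.of fun i k => Real.tanh (w i.succ - v k) - Real.tanh (w 0 - v k)) =
      .of fun i k => Real.sinh (w i.succ - w 0) *
        (Matrix.of fun i k => (Real.cosh (w 0 - v k))⁻¹ *
          (Matrix.of fun (i k : Fin n) => (Real.cosh (w i.succ - v k))⁻¹) i k) i k := by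
    ext i k
    simp only [Matrix.of_apply, tanh_sub_tanh, sub_sub_sub_cancel_right]
    ring
  rw [hmat, Matrix.det_mul_column, Matrix.det_mul_row, det_inv_cosh_sub (fun i => w i.succ) v]
  simp only [Fin.prod_univ_succ (n := n), Fin.prod_Ioi_zero, Fin.prod_Ioi_succ,
    Finset.prod_mul_distrib, Finset.prod_inv_distrib]
  have hne (t : ℝ) : Real.cosh t ≠ 0 := (Real.cosh_pos t).ne'
  have h2 : ∏ i : Fin n, Real.cosh (w 0 - v i) ≠ 0 := prod_ne_zero_iff.2 fun i _ => hne _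
  have h3 : ∏ i : Fin n, ∏ j : Fin n, Real.cosh (w i.succ - v j) ≠ 0 :=
    prod_ne_zero_iff.2 fun i _ => prod_ne_zero_iff.2 fun j _ => hne _
  field_simp

/-- Andréief's identity on the real line. -/
theorem integral_det_mul_det {n : ℕ} (f g : Fin n → ℝ → ℝ)
    (hfg : ∀ i j, Integrable fun x => f i x * g j x) :
    ∫ v : Fin n → ℝ, (Matrix.of fun i k => f i (v k)).det * (Matrix.of fun i k => g i (v k)).det
      = n.factorial * (Matrix.of fun i j => ∫ x, f i x * g j x).det := by
  have hexp (v : Fin n → ℝ) :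
      (Matrix.of fun i k => f i (v k)).det * (Matrix.of fun i k => g i (v k)).det =
      ∑ τ : Equiv.Perm (Fin n), ∑ σ : Equiv.Perm (Fin n),
        (((Equiv.Perm.sign τ : ℤ) : ℝ) * ((Equiv.Perm.sign σ : ℤ) : ℝ)) *
          ∏ k, f (σ k) (v k) * g (τ k) (v k) := by
    rw [mul_comm, Matrix.det_apply', Matrix.det_apply', Finset.sum_mul_sum]
    refine sum_congr rfl fun τ _ => sum_congr rfl fun σ _ => ?_
    rw [Finset.prod_mul_distrib]
    simp only [Matrix.of_apply]
    ring
  have hint (τ σ : Equiv.Perm (Fin n)) : Integrable fun v : Fin n → ℝ =>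
      (((Equiv.Perm.sign τ : ℤ) : ℝ) * ((Equiv.Perm.sign σ : ℤ) : ℝ)) *
          ∏ k, f (σ k) (v k) * g (τ k) (v k) :=
    (Integrable.fintype_prod fun k => hfg (σ k) (τ k)).const_mul _
  simp only [hexp]
  rw [integral_finsetSum _ fun τ _ => integrable_finsetSum _ fun σ _ => hint τ σ]
  have hτ (τ : Equiv.Perm (Fin n)) :
      ∫ v : Fin n → ℝ, ∑ σ : Equiv.Perm (Fin n),
        (((Equiv.Perm.sign τ : ℤ) : ℝ) * ((Equiv.Perm.sign σ : ℤ) : ℝ)) *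
          ∏ k, f (σ k) (v k) * g (τ k) (v k) =
      (Matrix.of fun i j => ∫ x, f i x * g j x).det := by
    rw [integral_finsetSum _ fun σ _ => hint τ σ]
    have hperm := Matrix.det_permute' τ (Matrix.of fun i j => ∫ x, f i x * g j x)
    rw [Matrix.det_apply'] at hperm
    calc _ = ((Equiv.Perm.sign τ : ℤ) : ℝ) * ∑ σ : Equiv.Perm (Fin n),
          ((Equiv.Perm.sign σ : ℤ) : ℝ) * ∏ k, ∫ x, f (σ k) x * g (τ k) x := by
          rw [Finset.mul_sum]
          refine sum_congr rfl fun σ _ => ?_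
          rw [integral_const_mul,
            integral_fintype_prod_volume_eq_prod (fun k x => f (σ k) x * g (τ k) x), mul_assoc]
      _ = _ := by
          simp only [Matrix.submatrix_apply, Matrix.of_apply, id] at hperm
          rw [hperm, ← mul_assoc, ← Int.cast_mul, ← Units.val_mul, Int.units_mul_self]
          simp
  simp [hτ, Fintype.card_perm]

theorem exp_neg_abs_mul_cosh_le (a x : ℝ) :
    Real.exp (-|a|) * Real.cosh x ≤ Real.cosh (a - x) := by
  rw [Real.cosh_eq, Real.cosh_eq]
  have h1 : Real.exp (-|a|) * Real.exp x ≤ Real.exp (-(a - x)) := by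
    rw [← Real.exp_add]; gcongr; linarith [le_abs_self a]
  have h2 : Real.exp (-|a|) * Real.exp (-x) ≤ Real.exp (a - x) := by
    rw [← Real.exp_add]; gcongr; linarith [neg_abs_le a]
  linarith

theorem inv_cosh_sub_le (a x : ℝ) :
    (Real.cosh (a - x))⁻¹ ≤ Real.exp |a| * (Real.cosh x)⁻¹ := by
  have h := exp_neg_abs_mul_cosh_le a x
  have hx := Real.cosh_pos x
  calc (Real.cosh (a - x))⁻¹ ≤ (Real.exp (-|a|) * Real.cosh x)⁻¹ := by gcongr
    _ = _ := by rw [mul_inv, ← Real.exp_neg, neg_neg]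

theorem integrable_one_add_abs_pow_div_cosh_sq (n : ℕ) :
    Integrable fun x : ℝ => (1 + |x|) ^ n / Real.cosh x ^ 2 := by
  have hne (t : ℝ) : Real.cosh t ≠ 0 := (Real.cosh_pos t).ne'
  refine (integrable_inv_one_add_sq.const_mul (2 * Real.exp 1 * (n + 2).factorial)).mono'
    (Continuous.aestronglyMeasurable ?_) (ae_of_all _ fun x => ?_)
  · exact ((continuous_const.add continuous_abs).pow n).div₀ (Real.continuous_cosh.pow 2)
      fun x => pow_ne_zero 2 (hne x)
  have hx := abs_nonneg x
  have hfac : (0 : ℝ) < (n + 2).factorial := by positivity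
  have h1 : (1 + |x|) ^ (n + 2) ≤ (n + 2).factorial * Real.exp (1 + |x|) := by
    have := Real.pow_div_factorial_le_exp (x := 1 + |x|) (by positivity) (n + 2)
    rwa [div_le_iff₀ hfac, mul_comm] at this
  have h2 : Real.exp |x| ≤ 2 * Real.cosh x := by
    rw [← Real.cosh_abs, Real.cosh_eq]
    linarith [Real.exp_pos (-|x|)]
  have h3 : Real.cosh x ≤ Real.cosh x ^ 2 := by nlinarith [Real.one_le_cosh x]
  have h4 : 1 + x ^ 2 ≤ (1 + |x|) ^ 2 := by nlinarith [sq_abs x]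
  rw [Real.norm_of_nonneg (by positivity), ← div_eq_mul_inv,
    div_le_div_iff₀ (by have := Real.cosh_pos x; positivity) (by positivity)]
  calc (1 + |x|) ^ n * (1 + x ^ 2) ≤ (1 + |x|) ^ n * (1 + |x|) ^ 2 := by gcongr
    _ = (1 + |x|) ^ (n + 2) := by ring
    _ ≤ (n + 2).factorial * Real.exp (1 + |x|) := h1
    _ = (n + 2).factorial * Real.exp 1 * Real.exp |x| := by rw [Real.exp_add]; ring
    _ ≤ (n + 2).factorial * Real.exp 1 * (2 * Real.cosh x ^ 2) := by
        gcongr; linarith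
    _ = _ := by ring

theorem integrable_pow_mul_inv_cosh_mul_inv_cosh (n : ℕ) (a b : ℝ) :
    Integrable fun x : ℝ => x ^ n * ((Real.cosh (a - x))⁻¹ * (Real.cosh (b - x))⁻¹) := by
  have hpos (t : ℝ) := Real.cosh_pos t
  refine ((integrable_one_add_abs_pow_div_cosh_sq n).const_mul (Real.exp |a| * Real.exp |b|)).mono'
    (Continuous.aestronglyMeasurable ?_) (ae_of_all _ fun x => ?_)
  · have h (c : ℝ) : Continuous fun x : ℝ => (Real.cosh (c - x))⁻¹ :=
      (Real.continuous_cosh.comp (continuous_const.sub continuous_id)).inv₀ fun x => (hpos _).ne'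
    exact (continuous_pow n).mul ((h a).mul (h b))
  have ha := inv_cosh_sub_le a x
  have hb := inv_cosh_sub_le b x
  have hxa := hpos (a - x)
  have hxb := hpos (b - x)
  have hx := hpos x
  have hpow : |x| ^ n ≤ (1 + |x|) ^ n := by gcongr; linarith
  rw [norm_mul, norm_pow, Real.norm_eq_abs, Real.norm_of_nonneg (by positivity)]
  calc _ ≤ (1 + |x|) ^ n *
        ((Real.exp |a| * (Real.cosh x)⁻¹) * (Real.exp |b| * (Real.cosh x)⁻¹)) := by gcongr
    _ = _ := by field_simp

theorem hasDerivAt_tanh (x : ℝ) : HasDerivAt Real.tanh ((Real.cosh x)⁻¹ * (Real.cosh x)⁻¹) x := by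
  have hx := (Real.cosh_pos x).ne'
  have h := (Real.hasDerivAt_sinh x).div (Real.hasDerivAt_cosh x) hx
  have he : Real.tanh = Real.sinh / Real.cosh := funext Real.tanh_eq_sinh_div_cosh
  rw [he]
  refine h.congr_deriv ?_
  have := Real.cosh_sq x
  field_simp
  linear_combination this

theorem tendsto_tanh_atTop : Filter.Tendsto Real.tanh Filter.atTop (nhds 1) := by
  have he (x : ℝ) : Real.tanh x = 1 - 2 / (Real.exp (2 * x) + 1) := by
    have hx := Real.exp_pos x
    rw [Real.tanh_eq, Real.exp_neg, two_mul, Real.exp_add]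
    field_simp
    ring
  have h : Filter.Tendsto (fun x : ℝ => Real.exp (2 * x) + 1) Filter.atTop Filter.atTop :=
    Filter.tendsto_atTop_add_const_right _ _
      (Real.tendsto_exp_atTop.comp (Filter.tendsto_id.const_mul_atTop two_pos))
  have h2 := (h.const_div_atTop 2).const_sub 1
  simpa only [← he, sub_zero] using h2

theorem tendsto_tanh_atBot : Filter.Tendsto Real.tanh Filter.atBot (nhds (-1)) := by
  have h := (tendsto_tanh_atTop.comp Filter.tendsto_neg_atBot_atTop).neg
  simpa [Function.comp_def] using h

theorem integral_inv_cosh_mul_inv_cosh :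
    ∫ x : ℝ, (Real.cosh x)⁻¹ * (Real.cosh x)⁻¹ = 2 := by
  have hint := integrable_pow_mul_inv_cosh_mul_inv_cosh 0 0 0
  simp only [pow_zero, one_mul, zero_sub, Real.cosh_neg] at hint
  rw [integral_of_hasDerivAt_of_tendsto hasDerivAt_tanh hint tendsto_tanh_atBot tendsto_tanh_atTop]
  norm_num

open Polynomial in
/-- The moments of the translates of `sech²` are twice monic polynomials in the translation. -/
theorem exists_monic_integral_pow_mul_inv_cosh (n : ℕ) :
    ∃ p : ℝ[X], p.Monic ∧ p.natDegree = n ∧ ∀ s : ℝ,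
      ∫ x : ℝ, x ^ n * ((Real.cosh (s - x))⁻¹ * (Real.cosh (s - x))⁻¹) = 2 * p.eval s := by
  let c : ℕ → ℝ := fun k => ∫ x : ℝ, x ^ k * ((Real.cosh x)⁻¹ * (Real.cosh x)⁻¹)
  have hint (k : ℕ) : Integrable fun x : ℝ => x ^ k * ((Real.cosh x)⁻¹ * (Real.cosh x)⁻¹) := by
    simpa using integrable_pow_mul_inv_cosh_mul_inv_cosh k 0 0
  have hc0 : c 0 = 2 := by simpa [c] using integral_inv_cosh_mul_inv_cosh
  let q : ℝ[X] := ∑ l ∈ range n, Polynomial.C (n.choose l * c (n - l) / 2) * X ^ l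
  have hq : q.degree < n := by
    refine (degree_sum_le _ _).trans_lt
      ((Finset.sup_lt_iff (WithBot.bot_lt_coe n)).2 fun l hl => ?_)
    refine (degree_C_mul_X_pow_le l _).trans_lt ?_
    exact WithBot.coe_lt_coe.2 (Finset.mem_range.1 hl)
  refine ⟨X ^ n + q, monic_X_pow_add hq, natDegree_eq_of_degree_eq_some ?_, fun s => ?_⟩
  · rw [degree_add_eq_left_of_degree_lt (by rwa [degree_X_pow]), degree_X_pow]
  calc ∫ x : ℝ, x ^ n * ((Real.cosh (s - x))⁻¹ * (Real.cosh (s - x))⁻¹)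
      = ∫ x : ℝ, (s + x) ^ n * ((Real.cosh x)⁻¹ * (Real.cosh x)⁻¹) := by
        rw [← integral_add_left_eq_self _ s]
        simp
    _ = ∫ x : ℝ, ∑ l ∈ range (n + 1), (s ^ l * n.choose l) *
          (x ^ (n - l) * ((Real.cosh x)⁻¹ * (Real.cosh x)⁻¹)) := by
        congr 1 with x
        rw [add_pow, Finset.sum_mul]
        exact sum_congr rfl fun l _ => by ring
    _ = ∑ l ∈ range (n + 1), (s ^ l * n.choose l) * c (n - l) := by
        rw [integral_finsetSum _ fun l _ => (hint _).const_mul _]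
        simp only [integral_const_mul, c]
    _ = _ := by
        rw [Finset.sum_range_succ]
        simp only [Nat.choose_self, Nat.sub_self, hc0, q, eval_add, eval_pow, eval_X,
          eval_finsetSum, eval_mul, eval_C, mul_add, Finset.mul_sum, Nat.cast_one]
        rw [add_comm]
        congr 1
        · ring
        · exact sum_congr rfl fun l _ => by ring

theorem integrable_pow_mul_tanh_sub_tanh (n : ℕ) (a b : ℝ) :
    Integrable fun x : ℝ => x ^ n * (Real.tanh (a - x) - Real.tanh (b - x)) := by
  refine ((integrable_pow_mul_inv_cosh_mul_inv_cosh n a b).const_mul (Real.sinh (a - b))).congr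
    (ae_of_all _ fun x => ?_)
  simp only [tanh_sub_tanh, sub_sub_sub_cancel_right]
  ring

/-- Integration by parts for the moments of a difference of hyperbolic tangents. -/
theorem integral_pow_mul_tanh_sub_tanh (n : ℕ) (a b : ℝ) :
    (n + 1) * ∫ x : ℝ, x ^ n * (Real.tanh (a - x) - Real.tanh (b - x)) =
      (∫ x : ℝ, x ^ (n + 1) * ((Real.cosh (a - x))⁻¹ * (Real.cosh (a - x))⁻¹)) -
      ∫ x : ℝ, x ^ (n + 1) * ((Real.cosh (b - x))⁻¹ * (Real.cosh (b - x))⁻¹) := by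
  have hA := integrable_pow_mul_inv_cosh_mul_inv_cosh (n + 1) a a
  have hB := integrable_pow_mul_inv_cosh_mul_inv_cosh (n + 1) b b
  have hT := (integrable_pow_mul_tanh_sub_tanh n a b).const_mul ((n : ℝ) + 1)
  have htanh (c x : ℝ) : HasDerivAt (fun x => Real.tanh (c - x))
      (-((Real.cosh (c - x))⁻¹ * (Real.cosh (c - x))⁻¹)) x := by
    simpa [Function.comp_def] using (hasDerivAt_tanh (c - x)).comp x ((hasDerivAt_id x).const_sub c)
  have hderiv (x : ℝ) : HasDerivAt
      (fun x : ℝ => x ^ (n + 1) * (Real.tanh (a - x) - Real.tanh (b - x)))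
      ((n + 1) * (x ^ n * (Real.tanh (a - x) - Real.tanh (b - x))) -
        (x ^ (n + 1) * ((Real.cosh (a - x))⁻¹ * (Real.cosh (a - x))⁻¹) -
          x ^ (n + 1) * ((Real.cosh (b - x))⁻¹ * (Real.cosh (b - x))⁻¹))) x := by
    have h := (hasDerivAt_pow (n + 1) x).mul ((htanh a x).sub (htanh b x))
    refine h.congr_deriv ?_
    simp only [Nat.add_sub_cancel, Nat.cast_add, Nat.cast_one, Pi.sub_apply]
    ring
  have h0 := integral_eq_zero_of_hasDerivAt_of_integrable hderiv (hT.sub (hA.sub hB))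
    (integrable_pow_mul_tanh_sub_tanh (n + 1) a b)
  have hAB := integral_sub hT (hA.sub hB)
  simp only [Pi.sub_apply] at hAB
  rw [hAB, integral_sub hA hB, integral_const_mul] at h0
  linarith

theorem integral_det_vandermonde_mul_det_tanh {n : ℕ} (w : Fin (n + 1) → ℝ) :
    ∫ v : Fin n → ℝ, (Matrix.vandermonde v).det *
      (Matrix.of fun i k => Real.tanh (w i.succ - v k) - Real.tanh (w 0 - v k)).det =
      2 ^ n * (Matrix.vandermonde w).det := by
  choose p hmonic hdeg hp using exists_monic_integral_pow_mul_inv_cosh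
  have hV (v : Fin n → ℝ) : (Matrix.vandermonde v).det =
      (Matrix.of fun (i : Fin n) k => (fun x : ℝ => x ^ (i : ℕ)) (v k)).det := by
    rw [← Matrix.det_transpose]
    rfl
  simp only [hV]
  have h := integral_det_mul_det (fun (i : Fin n) x => x ^ (i : ℕ))
    (fun i x => Real.tanh (w i.succ - x) - Real.tanh (w 0 - x))
    (fun i j => integrable_pow_mul_tanh_sub_tanh i _ _)
  rw [h]
  have hm : (Matrix.of fun i j : Fin n => ∫ x : ℝ, x ^ (i : ℕ) *
        (Real.tanh (w j.succ - x) - Real.tanh (w 0 - x))) =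
      .of fun i j => (2 / ((i : ℕ) + 1 : ℝ)) * (Matrix.of fun i j : Fin n =>
        (p (i + 1)).eval (w j.succ) - (p (i + 1)).eval (w 0)) i j := by
    ext i j
    have h1 := integral_pow_mul_tanh_sub_tanh i (w j.succ) (w 0)
    rw [hp, hp] at h1
    have h2 : ((i : ℕ) + 1 : ℝ) ≠ 0 := by positivity
    simp only [Matrix.of_apply]
    field_simp
    linear_combination h1
  have hfac : ∏ i : Fin n, ((i : ℕ) + 1 : ℝ) = n.factorial := by
    rw [Fin.prod_univ_eq_prod_range (fun i => (i + 1 : ℝ)), ← Finset.prod_range_add_one_eq_factorial]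
    push_cast
    rfl
  have hp0 : p 0 = 1 := (hmonic 0).natDegree_eq_zero.1 (hdeg 0)
  rw [hm, Matrix.det_mul_column, Finset.prod_div_distrib, hfac,
    Matrix.det_eval_matrixOfPolynomials_eq_det_vandermonde w (fun i => p i) (fun i => hdeg i)
      (fun i => hmonic i),
    det_eq_det_sub_first_row _ (by simp [hp0])]
  have : (n.factorial : ℝ) ≠ 0 := by positivity
  field_simp
  simp only [Finset.prod_const, Finset.card_univ, Fintype.card_fin]
  rw [← Matrix.det_transpose]
  rfl

theorem prod_filter_lt_eq_prod_Ioi {n : ℕ} {R : Type*} [CommMonoid R] (f : Fin n → Fin n → R) :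
    ∏ p ∈ univ.filter (fun p : Fin n × Fin n => p.1 < p.2), f p.1 p.2 =
      ∏ i, ∏ j ∈ Ioi i, f i j := by
  rw [Finset.prod_filter, Fintype.prod_prod_type]
  refine prod_congr rfl fun i _ => ?_
  rw [← Finset.prod_filter]
  refine prod_congr ?_ fun _ _ => rfl
  ext j
  simp

theorem prod_Ioi_mul_mul_prod {n : ℕ} {R : Type*} [CommMonoid R] (u : Fin n → R) :
    (∏ i, ∏ j ∈ Ioi i, u i * u j) * ∏ i, u i = ∏ i, u i ^ n := by
  induction n with
  | zero => simp
  | succ n ih =>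
    have h := ih fun i => u i.succ
    simp only [Fin.prod_univ_succ, Fin.prod_Ioi_zero, Fin.prod_Ioi_succ, Finset.prod_mul_distrib,
      Fin.prod_const, pow_succ] at h ⊢
    rw [← h]
    ac_rfl

theorem continuous_shr : Continuous shr := by
  have hds : shr = fun x => (dslope Real.sinh 0 x)⁻¹ := by
    funext x
    by_cases hx : x = 0
    · simp [shr, hx]
    · simp [shr, hx, dslope_of_ne, slope_def_field]
  have hne (x : ℝ) : dslope Real.sinh 0 x ≠ 0 := by
    by_cases hx : x = 0
    · simp [hx]
    · simp [hx, dslope_of_ne, slope_def_field]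
  rw [hds]
  refine Continuous.inv₀ (continuous_iff_continuousAt.2 fun x => ?_) hne
  by_cases hx : x = 0
  · subst hx
    exact continuousAt_dslope_same.2 Real.differentiable_sinh.differentiableAt
  · exact (continuousAt_dslope_of_ne hx).2 Real.continuous_sinh.continuousAt

theorem abs_sub_mul_sinh_sub_le (a b : ℝ) :
    |(a - b) * Real.sinh (a - b)| ≤
      (2 * (1 + |a|) * Real.cosh a) * (2 * (1 + |b|) * Real.cosh b) := by
  have hs (t : ℝ) : |Real.sinh t| ≤ Real.cosh t :=
    abs_le_of_sq_le_sq (by rw [Real.cosh_sq]; linarith) (Real.cosh_pos t).le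
  have ha := Real.cosh_pos a
  have hb := Real.cosh_pos b
  have h1 : |a - b| ≤ (1 + |a|) * (1 + |b|) := by
    nlinarith [abs_sub a b, abs_nonneg a, abs_nonneg b, mul_nonneg (abs_nonneg a) (abs_nonneg b)]
  have h2 : |Real.sinh (a - b)| ≤ 2 * (Real.cosh a * Real.cosh b) := by
    rw [Real.sinh_sub]
    calc _ ≤ |Real.sinh a * Real.cosh b| + |Real.cosh a * Real.sinh b| := abs_sub _ _
      _ = |Real.sinh a| * Real.cosh b + Real.cosh a * |Real.sinh b| := by
          rw [abs_mul, abs_mul, abs_of_pos ha, abs_of_pos hb]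
      _ ≤ Real.cosh a * Real.cosh b + Real.cosh a * Real.cosh b := by
          gcongr <;> exact hs _
      _ = _ := by ring
  rw [abs_mul]
  calc _ ≤ ((1 + |a|) * (1 + |b|)) * (2 * (Real.cosh a * Real.cosh b)) := by gcongr
    _ ≤ ((1 + |a|) * (1 + |b|)) * (4 * (Real.cosh a * Real.cosh b)) := by gcongr; norm_num
    _ = _ := by ring

theorem continuous_integral_prod_sub_mul_sinh (n : ℕ) :
    Continuous fun w : Fin (n + 1) → ℝ => ∫ v : Fin n → ℝ,
      (∏ i, ∏ j ∈ Ioi i, (v i - v j) * Real.sinh (v i - v j)) /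
        ∏ j, ∏ k, Real.cosh (w j - v k) := by
  have hpos (t : ℝ) := Real.cosh_pos t
  have hden (w : Fin (n + 1) → ℝ) (v : Fin n → ℝ) : ∏ j, ∏ k, Real.cosh (w j - v k) ≠ 0 :=
    prod_ne_zero_iff.2 fun j _ => prod_ne_zero_iff.2 fun k _ => (hpos _).ne'
  refine continuous_iff_continuousAt.2 fun w₀ => ?_
  set R : ℝ := ‖w₀‖ + 1 with hR
  refine continuousAt_of_dominated (bound := fun v => ∏ k : Fin n,
    (2 ^ n * Real.exp R ^ (n + 1)) * ((1 + |v k|) ^ n / Real.cosh (v k) ^ 2)) ?_ ?_ ?_ ?_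
  · refine Filter.Eventually.of_forall fun w => Continuous.aestronglyMeasurable ?_
    exact Continuous.div₀ (by fun_prop) (by fun_prop) (hden w)
  · have hw : ∀ᶠ w in nhds w₀, ‖w‖ < R :=
      continuous_norm.continuousAt.eventually_lt_const (by rw [hR]; linarith)
    filter_upwards [hw] with w hw
    refine ae_of_all _ fun v => ?_
    have hden_le : ∏ j, ∏ k, (Real.cosh (w j - v k))⁻¹ ≤
        ∏ k, (Real.exp R * (Real.cosh (v k))⁻¹) ^ (n + 1) := by
      calc _ ≤ ∏ j : Fin (n + 1), ∏ k, (Real.exp R * (Real.cosh (v k))⁻¹) := by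
            refine prod_le_prod (fun j _ => prod_nonneg fun k _ => (inv_pos.2 (hpos _)).le)
              fun j _ => prod_le_prod (fun k _ => (inv_pos.2 (hpos _)).le) fun k _ => ?_
            refine (inv_cosh_sub_le (w j) (v k)).trans ?_
            have := inv_pos.2 (hpos (v k))
            have hj : |w j| ≤ R := (norm_le_pi_norm w j).trans hw.le
            gcongr
        _ = _ := by simp [Finset.prod_pow]
    have hu (k : Fin n) : 0 < 2 * (1 + |v k|) * Real.cosh (v k) := by
      have := hpos (v k)
      positivity
    have hnum_le : |∏ i, ∏ j ∈ Ioi i, (v i - v j) * Real.sinh (v i - v j)| ≤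
        ∏ k, (2 * (1 + |v k|) * Real.cosh (v k)) ^ n / (2 * (1 + |v k|) * Real.cosh (v k)) := by
      rw [Finset.prod_div_distrib, le_div_iff₀ (prod_pos fun k _ => hu k), ← prod_Ioi_mul_mul_prod]
      refine mul_le_mul_of_nonneg_right ?_ (prod_nonneg fun k _ => (hu k).le)
      simp only [Finset.abs_prod]
      exact prod_le_prod (fun i _ => prod_nonneg fun j _ => abs_nonneg _) fun i _ =>
        prod_le_prod (fun j _ => abs_nonneg _) fun j _ => abs_sub_mul_sinh_sub_le _ _
    have hden_nonneg : 0 ≤ ∏ j, ∏ k, (Real.cosh (w j - v k))⁻¹ :=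
      prod_nonneg fun j _ => prod_nonneg fun k _ => (inv_pos.2 (hpos _)).le
    rw [div_eq_mul_inv, norm_mul, Real.norm_eq_abs]
    simp only [← Finset.prod_inv_distrib]
    rw [Real.norm_of_nonneg hden_nonneg]
    refine (mul_le_mul hnum_le hden_le hden_nonneg ((abs_nonneg _).trans hnum_le)).trans ?_
    rw [← Finset.prod_mul_distrib]
    refine prod_le_prod (fun k _ => ?_) fun k _ => ?_
    · have := hpos (v k)
      have := hu k
      positivity
    · have hc := hpos (v k)
      have ha := abs_nonneg (v k)
      calc _ ≤ (2 * (1 + |v k|) * Real.cosh (v k)) ^ n / Real.cosh (v k) *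
            (Real.exp R * (Real.cosh (v k))⁻¹) ^ (n + 1) := by
            gcongr
            nlinarith
        _ = _ := by
            rw [mul_pow, mul_pow, mul_pow, inv_pow]
            field_simp
            ring
  · exact Integrable.fintype_prod fun _ => (integrable_one_add_abs_pow_div_cosh_sq n).const_mul _
  · refine ae_of_all _ fun v => Continuous.continuousAt ?_
    exact Continuous.div₀ (by fun_prop) (by fun_prop) fun w => hden w v

theorem prod_sinh_mul_integral {n : ℕ} (w : Fin (n + 1) → ℝ) :
    (∏ i, ∏ j ∈ Ioi i, Real.sinh (w j - w i)) * ∫ v : Fin n → ℝ,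
      (∏ i, ∏ j ∈ Ioi i, (v i - v j) * Real.sinh (v i - v j)) /
        ∏ j, ∏ k, Real.cosh (w j - v k) =
      2 ^ n * ∏ i, ∏ j ∈ Ioi i, (w j - w i) := by
  rw [← Matrix.det_vandermonde, ← integral_det_vandermonde_mul_det_tanh, ← integral_const_mul]
  congr 1 with v
  have hswap : ∏ i, ∏ j ∈ Ioi i, (v i - v j) * Real.sinh (v i - v j) =
      (∏ i, ∏ j ∈ Ioi i, (v j - v i)) * ∏ i, ∏ j ∈ Ioi i, Real.sinh (v j - v i) := by
    simp only [← Finset.prod_mul_distrib]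
    refine prod_congr rfl fun i _ => prod_congr rfl fun j _ => ?_
    rw [← neg_sub (v j), Real.sinh_neg]
    ring
  rw [det_tanh_sub_tanh, Matrix.det_vandermonde, hswap]
  ring

theorem integral_eq_prod_shr_of_injective {n : ℕ} (w : Fin (n + 1) → ℝ)
    (hw : Function.Injective w) :
    ∫ v : Fin n → ℝ, (∏ i, ∏ j ∈ Ioi i, (v i - v j) * Real.sinh (v i - v j)) /
        ∏ j, ∏ k, Real.cosh (w j - v k) =
      2 ^ n * ∏ i, ∏ j ∈ Ioi i, shr (w i - w j) := by
  have hS : ∏ i, ∏ j ∈ Ioi i, Real.sinh (w j - w i) ≠ 0 :=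
    prod_ne_zero_iff.2 fun i _ => prod_ne_zero_iff.2 fun j hj =>
      Real.sinh_ne_zero.2 (sub_ne_zero.2 (hw.ne (Finset.mem_Ioi.1 hj).ne'))
  have hshr : ∏ i, ∏ j ∈ Ioi i, shr (w i - w j) =
      (∏ i, ∏ j ∈ Ioi i, (w j - w i)) / ∏ i, ∏ j ∈ Ioi i, Real.sinh (w j - w i) := by
    simp only [← Finset.prod_div_distrib]
    refine prod_congr rfl fun i _ => prod_congr rfl fun j hj => ?_
    have hij : w i - w j ≠ 0 := sub_ne_zero.2 (hw.ne (Finset.mem_Ioi.1 hj).ne)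
    rw [shr, if_neg hij, ← neg_sub (w j), Real.sinh_neg, neg_div_neg_eq]
  rw [hshr, ← mul_div_assoc, eq_div_iff hS, mul_comm, prod_sinh_mul_integral]

theorem eventually_injective_add_mul {n : ℕ} (w : Fin n → ℝ) :
    ∀ᶠ t : ℝ in nhdsWithin 0 {0}ᶜ, Function.Injective fun i => w i + t * (i : ℕ) := by
  have hpair (i j : Fin n) (hij : i ≠ j) :
      ∀ᶠ t : ℝ in nhdsWithin 0 {0}ᶜ, w i + t * (i : ℕ) ≠ w j + t * (j : ℕ) := by
    have hne : ((i : ℕ) : ℝ) - (j : ℕ) ≠ 0 :=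
      sub_ne_zero.2 fun h => hij (Fin.ext (Nat.cast_injective h))
    by_cases hw : w i = w j
    · filter_upwards [self_mem_nhdsWithin] with t ht h
      exact mul_ne_zero ht hne (by linear_combination h - hw)
    · refine Filter.Eventually.filter_mono nhdsWithin_le_nhds ?_
      have hc : ContinuousAt (fun t : ℝ => (w i + t * (i : ℕ)) - (w j + t * (j : ℕ))) 0 := by
        fun_prop
      filter_upwards [hc.eventually_ne (y := 0) (by simpa [sub_eq_zero] using hw)] with t ht
      exact sub_ne_zero.1 ht
  have hall : ∀ᶠ t : ℝ in nhdsWithin 0 {0}ᶜ, ∀ i j : Fin n, i ≠ j →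
      w i + t * (i : ℕ) ≠ w j + t * (j : ℕ) :=
    Filter.eventually_all.2 fun i => Filter.eventually_all.2 fun j =>
      Filter.eventually_all.2 fun hij => hpair i j hij
  filter_upwards [hall] with t ht i j h
  by_contra hij
  exact ht i j hij h

theorem integral_eq_prod_shr {n : ℕ} (w : Fin (n + 1) → ℝ) :
    ∫ v : Fin n → ℝ, (∏ i, ∏ j ∈ Ioi i, (v i - v j) * Real.sinh (v i - v j)) /
        ∏ j, ∏ k, Real.cosh (w j - v k) =
      2 ^ n * ∏ i, ∏ j ∈ Ioi i, shr (w i - w j) := by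
  let γ : ℝ → Fin (n + 1) → ℝ := fun t i => w i + t * (i : ℕ)
  have hγ : Continuous γ := by fun_prop
  have hγ0 : γ 0 = w := by simp [γ]
  have hR : Continuous fun w : Fin (n + 1) → ℝ =>
      (2 : ℝ) ^ n * ∏ i, ∏ j ∈ Ioi i, shr (w i - w j) :=
    continuous_const.mul <| continuous_finsetProd _ fun i _ => continuous_finsetProd _ fun j _ =>
      continuous_shr.comp ((continuous_apply i).sub (continuous_apply j))
  have h1 := (((continuous_integral_prod_sub_mul_sinh n).comp hγ).tendsto 0).mono_left
    (nhdsWithin_le_nhds (s := {0}ᶜ))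
  have h2 := ((hR.comp hγ).tendsto 0).mono_left (nhdsWithin_le_nhds (s := {0}ᶜ))
  have heq := (eventually_injective_add_mul w).mono fun t ht =>
    integral_eq_prod_shr_of_injective (γ t) ht
  have h := tendsto_nhds_unique (h1.congr' heq) h2
  simpa only [Function.comp_apply, hγ0] using h

/-- Evaluation of the `(N−1)`-dimensional integral
`B_{N−1}(w) = ∫ ∏_{m<n}(v_m−v_n)sinh(v_m−v_n) / ∏_{j,k} cosh(w_j−v_k) dv
 = 2^{N−1} ∏_{m<n} (w_m−w_n)/sinh(w_m−w_n)`. -/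
theorem BN_eval (N : ℕ) (hN : 2 ≤ N) (w : Fin N → ℝ) :
    ∫ v : Fin (N - 1) → ℝ,
        (∏ p ∈ Finset.univ.filter (fun p : Fin (N - 1) × Fin (N - 1) => p.1 < p.2),
          (v p.1 - v p.2) * Real.sinh (v p.1 - v p.2)) /
        ∏ j : Fin N, ∏ k : Fin (N - 1), Real.cosh (w j - v k)
      = 2 ^ (N - 1) *
          ∏ p ∈ Finset.univ.filter (fun p : Fin N × Fin N => p.1 < p.2),
            shr (w p.1 - w p.2) := by
  obtain ⟨n, rfl⟩ : ∃ n, N = n + 1 := ⟨N - 1, by omega⟩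
  have h := integral_eq_prod_shr w
  simp only [← prod_filter_lt_eq_prod_Ioi] at h
  exact h
end
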